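/- For every k ≥ 2, the set {χ''_c(G) : G is a finite graph with maximum degree k} is infinite. -/

import Mathlib

open SimpleGraph

/-- A proper total colouring of `G` with `p` colours: vertex colours `cv`,
edge colours `ce` (symmetric on adjacent pairs); adjacent vertices, adjacent
edges and incident vertex-edge pairs get distinct colours. -/
def IsTotalColoring {V : Type*} (G : SimpleGraph V) (p : ℕ)
    (cv : V → Fin p) (ce : V → V → Fin p) : Prop :=
  (∀ u v, G.Adj u v → ce u v = ce v u) ∧
  (∀ u v, G.Adj u v → cv u ≠ cv v) ∧
  (∀ u v w, G.Adj u v → G.Adj u w → v ≠ w → ce u v ≠ ce u w) ∧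
  (∀ u v, G.Adj u v → ce u v ≠ cv u ∧ ce u v ≠ cv v)

/-- circular distance condition: `q ≤ |a - b| ≤ p - q`. -/
def circOk (p q a b : ℕ) : Prop :=
  q ≤ max a b - min a b ∧ max a b - min a b ≤ p - q

/-- A `(p,q)`-total colouring of `G`. -/
def IsCircTotalColoring {V : Type*} (G : SimpleGraph V) (p q : ℕ)
    (cv : V → ℕ) (ce : V → V → ℕ) : Prop :=
  (∀ v, cv v < p) ∧
  (∀ u v, G.Adj u v → ce u v < p) ∧
  (∀ u v, G.Adj u v → ce u v = ce v u) ∧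
  (∀ u v, G.Adj u v → circOk p q (cv u) (cv v)) ∧
  (∀ u v w, G.Adj u v → G.Adj u w → v ≠ w → circOk p q (ce u v) (ce u w)) ∧
  (∀ u v, G.Adj u v → circOk p q (ce u v) (cv u) ∧ circOk p q (ce u v) (cv v))

/-- The circular total chromatic number of `G`. -/
noncomputable def circTotalChromatic {V : Type*} (G : SimpleGraph V) : ℝ :=
  sInf {x : ℝ | ∃ p q : ℕ, 0 < q ∧
    (∃ cv ce, IsCircTotalColoring G p q cv ce) ∧ x = (p : ℝ) / q}

/-- The chain graph `G_{k,n}`: `n` blocks, each a copy of `K_{k,k-1}` with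
partite sets `Fin k` (the `X`-side) and `Fin (k-1)` (the `Y`-side); in block `i`
the designated link vertices are `x_i = (i, inl 0)` and `x'_i = (i, inl 1)`;
the extra vertex `u` is `none`, joined to `x'_1` and `x_n`, and `x_i` is joined
to `x'_{i+1}`. -/
def Gkn (k n : ℕ) : SimpleGraph (Option (Fin n × (Fin k ⊕ Fin (k - 1)))) :=
  SimpleGraph.fromRel (fun a b =>
    (∃ (i : Fin n) (x : Fin k) (y : Fin (k - 1)),
        a = some (i, Sum.inl x) ∧ b = some (i, Sum.inr y)) ∨
    (∃ (i j : Fin n) (x x' : Fin k), (j : ℕ) = (i : ℕ) + 1 ∧ (x : ℕ) = 0 ∧ (x' : ℕ) = 1 ∧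
        a = some (i, Sum.inl x) ∧ b = some (j, Sum.inl x')) ∨
    (∃ (i : Fin n) (x' : Fin k), (i : ℕ) = 0 ∧ (x' : ℕ) = 1 ∧
        a = none ∧ b = some (i, Sum.inl x')) ∨
    (∃ (i : Fin n) (x : Fin k), (i : ℕ) = n - 1 ∧ (x : ℕ) = 0 ∧
        a = some (i, Sum.inl x) ∧ b = none))

open Filter Topology

/-! ### Circular colourings and the limiting argument -/

theorem circOk.symm {p q a b : ℕ} (h : circOk p q a b) : circOk p q b a := by
  unfold circOk at *
  omega

theorem circOk_mod {p q a b : ℕ} (hq : 0 < q) (h₁ : a + q ≤ b) (h₂ : b + q ≤ a + p) :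
    circOk p q (a % p) (b % p) := by
  obtain ⟨d, rfl⟩ := Nat.exists_eq_add_of_le (show a ≤ b by omega)
  have ha : a % p < p := Nat.mod_lt _ (by omega)
  have hb : (a + d) % p = (a % p + d) % p := by simp [Nat.add_mod]
  rw [hb]
  unfold circOk
  by_cases h : a % p + d < p
  · rw [Nat.mod_eq_of_lt h]
    omega
  · have hm : (a % p + d) % p = a % p + d - p := by
      rw [Nat.mod_eq_sub_mod (by omega), Nat.mod_eq_of_lt (by omega)]
    rw [hm]
    omega

/-- Rounding down turns circular distance at least one on a circle of length `r` into distinct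
colours among `r`. -/
theorem natFloor_mod_ne {r : ℕ} {a b : ℝ} (ha : 0 ≤ a) (hb : 0 ≤ b)
    (har : a ≤ r) (hbr : b ≤ r) (h₁ : 1 ≤ |a - b|) (h₂ : |a - b| ≤ r - 1) :
    ⌊a⌋₊ % r ≠ ⌊b⌋₊ % r := by
  wlog hab : a ≤ b generalizing a b
  · rw [abs_sub_comm] at h₁ h₂
    exact (this hb ha hbr har h₁ h₂ (le_of_not_ge hab)).symm
  rw [abs_sub_comm, abs_of_nonneg (by linarith)] at h₁ h₂
  intro h
  have ha' := Nat.lt_floor_add_one a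
  have hb' := Nat.floor_le hb
  have hfb : ⌊b⌋₊ ≤ r := Nat.floor_le_of_le hbr
  have hfa : ⌊a⌋₊ < r := by
    have : (⌊a⌋₊ : ℝ) < r := by linarith [Nat.floor_le ha]
    exact_mod_cast this
  rw [Nat.mod_eq_of_lt hfa] at h
  have hlt : ⌊a⌋₊ < ⌊b⌋₊ :=
    Nat.lt_of_succ_le (Nat.le_floor (by push_cast; linarith [Nat.floor_le ha]))
  rcases hfb.lt_or_eq with hlt' | heq
  · rw [Nat.mod_eq_of_lt hlt'] at h
    omega
  · rw [heq, Nat.mod_self] at h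
    rw [heq] at hb'
    rw [h] at ha'
    norm_num at ha'
    linarith

theorem circOk.one_le_abs_sub_div {p q a b : ℕ} (hq : 0 < q) (h : circOk p q a b) :
    1 ≤ |(a : ℝ) / q - b / q| ∧ |(a : ℝ) / q - b / q| ≤ (p : ℝ) / q - 1 := by
  have hq' : (0 : ℝ) < q := by exact_mod_cast hq
  wlog hab : a ≤ b generalizing a b
  · rw [abs_sub_comm]
    exact this h.symm (le_of_not_ge hab)
  obtain ⟨h₁, h₂⟩ := h
  rw [max_eq_right hab, min_eq_left hab] at h₁ h₂
  have h₁' : (a : ℝ) + q ≤ b := by exact_mod_cast (show a + q ≤ b by omega)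
  have h₂' : (b : ℝ) + q ≤ a + p := by exact_mod_cast (show b + q ≤ a + p by omega)
  have hpq : (p : ℝ) / q - 1 = (p - q) / q := by field_simp
  rw [abs_sub_comm, ← sub_div, hpq, abs_of_nonneg (div_nonneg (by linarith) hq'.le)]
  exact ⟨(one_le_div hq').2 (by linarith), div_le_div_of_nonneg_right (by linarith) hq'.le⟩

/-- A finite graph with circular total chromatic number at most `r` has a total colouring with
`r` colours. -/
theorem exists_isTotalColoring_of_circTotalChromatic_le {V : Type*} [Finite V]
    (G : SimpleGraph V) {r : ℕ} (hr : 0 < r)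
    (hne : ∃ p q cv ce, 0 < q ∧ IsCircTotalColoring G p q cv ce)
    (hle : circTotalChromatic G ≤ r) : ∃ cv ce, IsTotalColoring G r cv ce := by
  classical
  have key : ∀ m : ℕ, ∃ p q : ℕ, ∃ cv ce, 0 < q ∧ IsCircTotalColoring G p q cv ce ∧
      (p : ℝ) / q < r + 1 / ((m : ℝ) + 1) := by
    intro m
    have hlt : circTotalChromatic G < r + 1 / ((m : ℝ) + 1) :=
      hle.trans_lt (lt_add_of_pos_right _ Nat.one_div_pos_of_nat)
    obtain ⟨p₀, q₀, cv₀, ce₀, hq₀, h₀⟩ := hne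
    obtain ⟨x, ⟨p, q, hq, ⟨cv, ce, h⟩, rfl⟩, hx⟩ :=
      exists_lt_of_csInf_lt (by exact ⟨_, p₀, q₀, hq₀, ⟨cv₀, ce₀, h₀⟩, rfl⟩) hlt
    exact ⟨p, q, cv, ce, hq, h, hx⟩
  choose p q cv ce hq hcol hpq using key
  let F : ℕ → (V ⊕ V × V) → ℝ := fun m =>
    Sum.elim (fun v => (cv m v : ℝ) / q m)
      (fun e => if G.Adj e.1 e.2 then (ce m e.1 e.2 : ℝ) / q m else 0)
  have hdiv : ∀ m a, a < p m → (a : ℝ) / q m ≤ r + 1 / ((m : ℝ) + 1) := by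
    intro m a ha
    refine le_trans ?_ (hpq m).le
    gcongr
  have hF0 : ∀ m s, 0 ≤ F m s := by
    rintro m (v | e)
    · simp only [F, Sum.elim_inl]; positivity
    · simp only [F, Sum.elim_inr]; split_ifs <;> positivity
  have hFr : ∀ m s, F m s ≤ r + 1 / ((m : ℝ) + 1) := by
    rintro m (v | e)
    · exact hdiv m _ ((hcol m).1 v)
    · simp only [F, Sum.elim_inr]
      split_ifs with h
      · exact hdiv m _ ((hcol m).2.1 _ _ h)
      · positivity
  have hmem : ∀ m, F m ∈ Set.pi Set.univ fun _ => Set.Icc (0 : ℝ) (r + 1) := by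
    intro m s _
    refine ⟨hF0 m s, (hFr m s).trans ?_⟩
    have : 1 / ((m : ℝ) + 1) ≤ 1 := by
      rw [div_le_one (by positivity)]
      linarith [(Nat.cast_nonneg m : (0 : ℝ) ≤ m)]
    linarith
  obtain ⟨a, -, φ, hφ, hlim⟩ :=
    (isCompact_univ_pi fun _ : V ⊕ V × V => isCompact_Icc).tendsto_subseq hmem
  have hlim' : ∀ s, Tendsto (fun m => F (φ m) s) atTop (𝓝 (a s)) := tendsto_pi_nhds.1 hlim
  have herr : ∀ c : ℝ, Tendsto (fun m => c + 1 / ((φ m : ℝ) + 1)) atTop (𝓝 c) := by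
    intro c
    simpa using (tendsto_one_div_add_atTop_nhds_zero_nat.comp hφ.tendsto_atTop).const_add c
  have ha0 : ∀ s, 0 ≤ a s := fun s => ge_of_tendsto' (hlim' s) fun m => hF0 _ s
  have har : ∀ s, a s ≤ r := fun s => le_of_tendsto_of_tendsto' (hlim' s) (herr r) fun m => hFr _ s
  have hsep : ∀ s t, (∀ m, 1 ≤ |F m s - F m t| ∧ |F m s - F m t| ≤ (p m : ℝ) / q m - 1) →
      ⌊a s⌋₊ % r ≠ ⌊a t⌋₊ % r := by
    intro s t h
    have hl := ((hlim' s).sub (hlim' t)).abs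
    refine natFloor_mod_ne (ha0 s) (ha0 t) (har s) (har t)
      (ge_of_tendsto' hl fun m => (h _).1) (le_of_tendsto_of_tendsto' hl (herr _) fun m => ?_)
    linarith [(h (φ m)).2, hpq (φ m)]
  refine ⟨fun v => ⟨⌊a (.inl v)⌋₊ % r, Nat.mod_lt _ hr⟩,
    fun u v => ⟨⌊a (.inr (u, v))⌋₊ % r, Nat.mod_lt _ hr⟩, ?_, ?_, ?_, ?_⟩
  · intro u v huv
    have : a (.inr (u, v)) = a (.inr (v, u)) := by
      refine tendsto_nhds_unique (hlim' _) ((hlim' (.inr (v, u))).congr fun m => ?_)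
      simp [F, huv, huv.symm, (hcol (φ m)).2.2.1 u v huv]
    simp [this]
  · intro u v huv h
    refine hsep (.inl u) (.inl v) (fun m => ?_) (Fin.val_eq_of_eq h)
    exact ((hcol m).2.2.2.1 u v huv).one_le_abs_sub_div (hq m)
  · intro u v w huv huw hvw h
    refine hsep (.inr (u, v)) (.inr (u, w)) (fun m => ?_) (Fin.val_eq_of_eq h)
    simpa [F, huv, huw] using ((hcol m).2.2.2.2.1 u v w huv huw hvw).one_le_abs_sub_div (hq m)
  · intro u v huv
    constructor
    · intro h
      refine hsep (.inr (u, v)) (.inl u) (fun m => ?_) (Fin.val_eq_of_eq h)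
      simpa [F, huv] using ((hcol m).2.2.2.2.2 u v huv).1.one_le_abs_sub_div (hq m)
    · intro h
      refine hsep (.inr (u, v)) (.inl v) (fun m => ?_) (Fin.val_eq_of_eq h)
      simpa [F, huv] using ((hcol m).2.2.2.2.2 u v huv).2.one_le_abs_sub_div (hq m)

/-! ### Invariance under isomorphism -/

theorem IsCircTotalColoring.comp_iso {V W : Type*} {G : SimpleGraph V} {H : SimpleGraph W}
    (φ : G ≃g H) {p q : ℕ} {cv : W → ℕ} {ce : W → W → ℕ} (h : IsCircTotalColoring H p q cv ce) :
    IsCircTotalColoring G p q (fun v => cv (φ v)) (fun u v => ce (φ u) (φ v)) := by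
  obtain ⟨h₁, h₂, h₃, h₄, h₅, h₆⟩ := h
  exact ⟨fun v => h₁ _, fun u v huv => h₂ _ _ (φ.map_adj_iff.2 huv),
    fun u v huv => h₃ _ _ (φ.map_adj_iff.2 huv), fun u v huv => h₄ _ _ (φ.map_adj_iff.2 huv),
    fun u v w huv huw hvw => h₅ _ _ _ (φ.map_adj_iff.2 huv) (φ.map_adj_iff.2 huw)
      (φ.injective.ne hvw), fun u v huv => h₆ _ _ (φ.map_adj_iff.2 huv)⟩

theorem circTotalChromatic_congr {V W : Type*} {G : SimpleGraph V} {H : SimpleGraph W}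
    (φ : G ≃g H) : circTotalChromatic G = circTotalChromatic H := by
  unfold circTotalChromatic
  congr 1
  ext x
  constructor
  · rintro ⟨p, q, hq, ⟨cv, ce, h⟩, rfl⟩
    exact ⟨p, q, hq, ⟨_, _, h.comp_iso φ.symm⟩, rfl⟩
  · rintro ⟨p, q, hq, ⟨cv, ce, h⟩, rfl⟩
    exact ⟨p, q, hq, ⟨_, _, h.comp_iso φ⟩, rfl⟩

theorem ncard_neighborSet_congr {V W : Type*} {G : SimpleGraph V} {H : SimpleGraph W}
    (φ : G ≃g H) (v : V) : (G.neighborSet v).ncard = (H.neighborSet (φ v)).ncard :=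
  Nat.card_congr (φ.mapNeighborSet v)

/-! ### Adjacency and degrees in the chain graph -/

section Gkn

variable {k n : ℕ}

theorem Gkn_not_adj_none_none : ¬ (Gkn k n).Adj none none := (Gkn k n).loopless.irrefl _

theorem Gkn_adj_none_inl {i : Fin n} {x : Fin k} :
    (Gkn k n).Adj none (some (i, .inl x)) ↔
      ((i : ℕ) = 0 ∧ (x : ℕ) = 1) ∨ ((i : ℕ) = n - 1 ∧ (x : ℕ) = 0) := by
  simp [Gkn]

theorem Gkn_not_adj_none_inr {i : Fin n} {y : Fin (k - 1)} :
    ¬ (Gkn k n).Adj none (some (i, .inr y)) := by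
  simp [Gkn]

theorem Gkn_adj_inl_inl {i j : Fin n} {x x' : Fin k} :
    (Gkn k n).Adj (some (i, .inl x)) (some (j, .inl x')) ↔
      ((j : ℕ) = i + 1 ∧ (x : ℕ) = 0 ∧ (x' : ℕ) = 1) ∨
      ((i : ℕ) = j + 1 ∧ (x' : ℕ) = 0 ∧ (x : ℕ) = 1) := by
  simp only [Gkn, fromRel_adj, ne_eq, Option.some.injEq, Prod.mk.injEq, Sum.inl.injEq,
    reduceCtorEq, and_false, false_and, exists_false, false_or, or_false]
  constructor
  · rintro ⟨-, ⟨_, _, _, _, h₁, h₂, h₃, ⟨rfl, rfl⟩, rfl, rfl⟩ |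
      ⟨_, _, _, _, h₁, h₂, h₃, ⟨rfl, rfl⟩, rfl, rfl⟩⟩
    · exact .inl ⟨h₁, h₂, h₃⟩
    · exact .inr ⟨h₁, h₂, h₃⟩
  · rintro (⟨h₁, h₂, h₃⟩ | ⟨h₁, h₂, h₃⟩)
    · exact ⟨fun h => by simp [h.1] at h₁,
        .inl ⟨_, _, _, _, h₁, h₂, h₃, ⟨rfl, rfl⟩, rfl, rfl⟩⟩
    · exact ⟨fun h => by simp [h.1] at h₁,
        .inr ⟨_, _, _, _, h₁, h₂, h₃, ⟨rfl, rfl⟩, rfl, rfl⟩⟩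

theorem Gkn_adj_inl_inr {i j : Fin n} {x : Fin k} {y : Fin (k - 1)} :
    (Gkn k n).Adj (some (i, .inl x)) (some (j, .inr y)) ↔ i = j := by
  simp only [Gkn, fromRel_adj, ne_eq, Option.some.injEq, Prod.mk.injEq, Sum.inl.injEq,
    Sum.inr.injEq, reduceCtorEq, and_false, false_and, exists_false, or_false,
    not_false_eq_true, true_and]
  constructor
  · rintro ⟨_, _, _, ⟨rfl, rfl⟩, rfl, rfl⟩
    rfl
  · rintro rfl
    exact ⟨_, _, _, ⟨rfl, rfl⟩, rfl, rfl⟩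

theorem Gkn_not_adj_inr_inr {i j : Fin n} {y y' : Fin (k - 1)} :
    ¬ (Gkn k n).Adj (some (i, .inr y)) (some (j, .inr y')) := by
  simp [Gkn]

theorem Gkn_adj_inl_none {i : Fin n} {x : Fin k} :
    (Gkn k n).Adj (some (i, .inl x)) none ↔
      ((i : ℕ) = 0 ∧ (x : ℕ) = 1) ∨ ((i : ℕ) = n - 1 ∧ (x : ℕ) = 0) := by
  rw [SimpleGraph.adj_comm, Gkn_adj_none_inl]

theorem Gkn_not_adj_inr_none {i : Fin n} {y : Fin (k - 1)} :
    ¬ (Gkn k n).Adj (some (i, .inr y)) none := by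
  rw [SimpleGraph.adj_comm]
  exact Gkn_not_adj_none_inr

theorem Gkn_adj_inr_inl {i j : Fin n} {x : Fin k} {y : Fin (k - 1)} :
    (Gkn k n).Adj (some (i, .inr y)) (some (j, .inl x)) ↔ j = i := by
  rw [SimpleGraph.adj_comm, Gkn_adj_inl_inr]

theorem Gkn_ncard_neighborSet_inr (i : Fin n) (y : Fin (k - 1)) :
    ((Gkn k n).neighborSet (some (i, .inr y))).ncard = k := by
  have h : (Gkn k n).neighborSet (some (i, .inr y)) =
      Set.range fun x : Fin k => (some (i, .inl x) : Option (Fin n × (Fin k ⊕ Fin (k - 1)))) := by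
    ext (_ | ⟨j, x | y'⟩)
    · simp [Gkn_not_adj_inr_none]
    · simp [Gkn_adj_inr_inl, eq_comm]
    · simp [Gkn_not_adj_inr_inr]
  rw [h, ← Nat.card_coe_set_eq, Nat.card_range_of_injective fun a b hab => by simpa using hab,
    Nat.card_fin]

theorem Gkn_ncard_neighborSet_le (hk : 2 ≤ k) (v : Option (Fin n × (Fin k ⊕ Fin (k - 1)))) :
    ((Gkn k n).neighborSet v).ncard ≤ k := by
  have hcard : (Finset.range k : Set ℕ).ncard = k := by
    rw [Set.ncard_coe_finset, Finset.card_range]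
  rcases v with _ | ⟨i, x | y⟩
  · let g : Option (Fin n × (Fin k ⊕ Fin (k - 1))) → ℕ := fun w =>
      match w with
      | some (_, .inl x) => x
      | _ => 0
    refine (Set.ncard_le_ncard_of_injOn (t := (Finset.range k : Set ℕ)) g ?_ ?_
      (Finset.finite_toSet _)).trans_eq hcard
    · rintro (_ | ⟨j, x | y⟩) - <;> simp [g] <;> omega
    · rintro (_ | ⟨j, x | y⟩) h (_ | ⟨j', x' | y'⟩) h' he <;>
        simp only [mem_neighborSet, Gkn_not_adj_none_none, Gkn_not_adj_none_inr,
          Gkn_adj_none_inl] at h h'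
      simp only [g] at he
      simp only [Option.some.injEq, Prod.mk.injEq, Sum.inl.injEq, Fin.ext_iff]
      omega
  · let g : Option (Fin n × (Fin k ⊕ Fin (k - 1))) → ℕ := fun w =>
      match w with
      | some (_, .inr y) => y
      | _ => k - 1
    refine (Set.ncard_le_ncard_of_injOn (t := (Finset.range k : Set ℕ)) g ?_ ?_
      (Finset.finite_toSet _)).trans_eq hcard
    · rintro (_ | ⟨j, x | y⟩) - <;> simp [g] <;> omega
    · rintro (_ | ⟨j, x | y⟩) h (_ | ⟨j', x' | y'⟩) h' he <;>
        simp only [mem_neighborSet, Gkn_adj_inl_none, Gkn_adj_inl_inl, Gkn_adj_inl_inr] at h h' <;>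
        simp only [g] at he <;>
        simp only [Option.some.injEq, Prod.mk.injEq, Sum.inl.injEq, Sum.inr.injEq, Fin.ext_iff,
          reduceCtorEq] <;>
        omega
  · exact (Gkn_ncard_neighborSet_inr i y).le

/-! ### The chain graph has no total colouring with `k + 1` colours -/

/-- In a total colouring of `K_{k,k-1}` with `k + 1` colours, a colour that avoids a vertex `x` of
the larger side and all edges at `x` is the colour of each vertex on the smaller side. -/
theorem eq_of_block_coloring (f : Fin k → Fin (k + 1)) (g : Fin (k - 1) → Fin (k + 1))
    (h : Fin k → Fin (k - 1) → Fin (k + 1))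
    (hfg : ∀ x y, f x ≠ g y) (hf : ∀ x y, h x y ≠ f x) (hg : ∀ x y, h x y ≠ g y)
    (hx : ∀ x, Function.Injective (h x)) (hy : ∀ y, Function.Injective fun x => h x y)
    (x : Fin k) (c : Fin (k + 1)) (hcf : c ≠ f x) (hch : ∀ y, c ≠ h x y) (y : Fin (k - 1)) :
    c = g y := by
  have hfinj : Function.Injective f := by
    intro x₁ x₂ he
    by_contra hne
    have hex : ∀ y, ∃ x, h x y = f x₁ := by
      intro y
      have hinj : Function.Injective (Option.elim · (g y) fun x => h x y) := by
        rintro (_ | a) (_ | b) hab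
        · rfl
        · exact absurd hab.symm (hg _ _)
        · exact absurd hab (hg _ _)
        · exact congrArg some (hy y hab)
      obtain ⟨_ | a, ha⟩ := ((Fintype.bijective_iff_injective_and_card _).2
        ⟨hinj, by simp⟩).surjective (f x₁)
      · exact absurd ha.symm (hfg _ _)
      · exact ⟨a, ha⟩
    choose σ hσ using hex
    have hσinj : Function.Injective σ := by
      intro a b hab
      apply hx (σ a)
      rw [hσ, hab, hσ]
    have hsub : Finset.univ.image σ ⊆ (Finset.univ.erase x₁).erase x₂ := by
      intro z hz
      obtain ⟨y, -, rfl⟩ := Finset.mem_image.1 hz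
      simp only [Finset.mem_erase, Finset.mem_univ, and_true]
      refine ⟨fun hz => hf (σ y) y ?_, fun hz => hf (σ y) y ?_⟩
      · rw [hσ, hz, he]
      · rw [hσ, hz]
    have := Finset.card_le_card hsub
    rw [Finset.card_image_of_injective _ hσinj, Finset.card_erase_of_mem (by simp [Ne.symm hne]),
      Finset.card_erase_of_mem (by simp)] at this
    have hk₁ := x₁.isLt
    have hk₂ := x₂.isLt
    have hv := Fin.val_ne_of_ne hne
    simp at this
    omega
  have hcard : ∀ s : Finset (Fin (k + 1)), k ≤ s.card → ∀ a ∉ s, ∀ b ∉ s, a = b := by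
    intro s hs a ha b hb
    by_contra hab
    have := Finset.card_le_univ (insert a (insert b s))
    rw [Finset.card_insert_of_notMem (by simp [hab, ha]), Finset.card_insert_of_notMem hb] at this
    simp at this
    omega
  have hconst : ∀ y', g y' = g y := fun y' =>
    hcard (Finset.univ.image f) (by simp [Finset.card_image_of_injective _ hfinj]) _
      (by simpa using fun a => hfg a y') _ (by simpa using fun a => hfg a y)
  refine hcard (insert (f x) (Finset.univ.image (h x))) ?_ _ ?_ _ ?_
  · rw [Finset.card_insert_of_notMem (by simpa using hf x),
      Finset.card_image_of_injective _ (hx x)]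
    simp
    omega
  · simpa [hcf] using fun a => (hch a).symm
  · simp only [Finset.mem_insert, Finset.mem_image, Finset.mem_univ, true_and, not_or, not_exists]
    exact ⟨(hfg x y).symm, fun a ha => hg x a (ha.trans (hconst a).symm)⟩

theorem Gkn_not_isTotalColoring (hk : 2 ≤ k) (hn : 0 < n) :
    ¬ ∃ cv ce, IsTotalColoring (Gkn k n) (k + 1) cv ce := by
  rintro ⟨cv, ce, hsymm, hv, he, hve⟩
  have y : Fin (k - 1) := ⟨0, by omega⟩
  have key : ∀ (i : Fin n) (x : Fin k) w, (Gkn k n).Adj (some (i, .inl x)) w →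
      (∀ y, w ≠ some (i, .inr y)) → ce (some (i, .inl x)) w = cv (some (i, .inr y)) := by
    intro i x w hw hwy
    have hxy : ∀ x y, (Gkn k n).Adj (some (i, .inl x)) (some (i, .inr y)) :=
      fun _ _ => Gkn_adj_inl_inr.2 rfl
    refine eq_of_block_coloring (fun x => cv (some (i, .inl x))) (fun y => cv (some (i, .inr y)))
      (fun x y => ce (some (i, .inl x)) (some (i, .inr y))) (fun x y => hv _ _ (hxy x y))
      (fun x y => (hve _ _ (hxy x y)).1) (fun x y => (hve _ _ (hxy x y)).2) ?_ ?_ x _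
      (hve _ _ hw).1 (fun y => he _ _ _ hw (hxy x y) (hwy y)) y
    · intro x a b hab
      by_contra hne
      exact he _ _ _ (hxy x a) (hxy x b) (by simpa using hne) hab
    · intro y a b hab
      by_contra hne
      refine he (some (i, .inr y)) _ _ (hxy a y).symm (hxy b y).symm (by simpa using hne) ?_
      rw [← hsymm _ _ (hxy a y), ← hsymm _ _ (hxy b y)]
      exact hab
  have hconst : ∀ (m : ℕ) (hm : m < n),
      cv (some (⟨m, hm⟩, .inr y)) = cv (some (⟨0, hn⟩, .inr y)) := by
    intro m
    induction m with
    | zero => exact fun _ => rfl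
    | succ m ih =>
      intro hm
      have hadj : (Gkn k n).Adj (some (⟨m, by omega⟩, .inl ⟨0, by omega⟩))
          (some (⟨m + 1, hm⟩, .inl ⟨1, by omega⟩)) := Gkn_adj_inl_inl.2 (by simp)
      rw [← ih (by omega), ← key _ _ _ hadj (by simp), ← key _ _ _ hadj.symm (by simp)]
      exact hsymm _ _ hadj.symm
  have h₀ : (Gkn k n).Adj none (some (⟨0, hn⟩, .inl ⟨1, by omega⟩)) :=
    Gkn_adj_none_inl.2 (by simp)
  have h₁ : (Gkn k n).Adj none (some (⟨n - 1, by omega⟩, .inl ⟨0, by omega⟩)) :=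
    Gkn_adj_none_inl.2 (by simp)
  refine he _ _ _ h₀ h₁ (by simp) ?_
  rw [hsymm _ _ h₀, hsymm _ _ h₁, key _ _ _ h₀.symm (by simp), key _ _ _ h₁.symm (by simp),
    hconst (n - 1)]

/-! ### A circular total colouring of the chain graph -/

/-- A cyclic Latin square with entries `1, …, k`. -/
def latin (k x l : ℕ) : ℕ := 1 + (k - x + l) % k

theorem latin_pos (x l : ℕ) : 1 ≤ latin k x l := by
  unfold latin
  omega

theorem latin_le {x l : ℕ} (hk : 0 < k) : latin k x l ≤ k := by
  have := Nat.mod_lt (k - x + l) hk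
  unfold latin
  omega

theorem latin_ne_right {x l l' : ℕ} (hl : l < k) (hl' : l' < k) (h : l ≠ l') :
    latin k x l ≠ latin k x l' := by
  intro he
  have he' : k - x + l ≡ k - x + l' [MOD k] := by
    unfold latin at he
    unfold Nat.ModEq
    omega
  exact h ((Nat.ModEq.add_left_cancel' _ he').eq_of_lt_of_lt hl hl')

theorem latin_ne_left {x x' l : ℕ} (hx : x < k) (hx' : x' < k) (h : x ≠ x') :
    latin k x l ≠ latin k x' l := by
  intro he
  have he' : k - x + l ≡ k - x' + l [MOD k] := by
    unfold latin at he
    unfold Nat.ModEq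
    omega
  have h₁ := (Nat.ModEq.add_right_cancel' _ he').add_right (x + x')
  have h₂ : k - x + (x + x') = x' + k := by omega
  have h₃ : k - x' + (x + x') = x + k := by omega
  rw [h₂, h₃] at h₁
  exact h ((Nat.ModEq.add_right_cancel' _ h₁).eq_of_lt_of_lt hx' hx).symm

theorem latin_zero_zero : latin k 0 0 = 1 := by simp [latin]

theorem latin_one_zero (hk : 2 ≤ k) : latin k 1 0 = k := by
  rw [latin, Nat.mod_eq_of_lt (by omega)]
  omega

/-- Vertex colours, before reduction modulo the number of colours. -/
def chainVertexColor (k n q : ℕ) : Option (Fin n × (Fin k ⊕ Fin (k - 1))) → ℕ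
  | none => q
  | some (i, .inl x) => i + 1 + q * latin k x 0
  | some (i, .inr _) => i + 1

/-- Edge colours, before reduction modulo the number of colours. -/
def chainEdgeColor (k n q : ℕ) : Option (Fin n × (Fin k ⊕ Fin (k - 1))) →
    Option (Fin n × (Fin k ⊕ Fin (k - 1))) → ℕ
  | none, some (_, .inl x) => if (x : ℕ) = 0 then n else 0
  | some (_, .inl x), none => if (x : ℕ) = 0 then n else 0
  | some (i, .inl _), some (j, .inl _) => max i j
  | some (i, .inl x), some (_, .inr y) => i + 1 + q * latin k x (y + 1)
  | some (_, .inr y), some (i, .inl x) => i + 1 + q * latin k x (y + 1)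
  | _, _ => 0

theorem circOk_lattice {q s j j' : ℕ} (hq : 0 < q) (hj : j ≤ k) (hj' : j' ≤ k) (h : j ≠ j') :
    circOk ((k + 1) * q + 1) q ((s + q * j) % ((k + 1) * q + 1))
      ((s + q * j') % ((k + 1) * q + 1)) := by
  wlog hlt : j < j' generalizing j j'
  · exact (this hj' hj h.symm (by omega)).symm
  apply circOk_mod hq <;> nlinarith

theorem circOk_lattice_link {q s j t : ℕ} (hq : 0 < q) (hj : 1 ≤ j) (hj' : j ≤ k)
    (ht : t = s ∨ t = s + 1) :
    circOk ((k + 1) * q + 1) q (t % ((k + 1) * q + 1))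
      ((s + 1 + q * j) % ((k + 1) * q + 1)) := by
  rcases ht with rfl | rfl <;> apply circOk_mod hq <;> nlinarith

theorem chainEdgeColor_comm {q : ℕ} (u v : Option (Fin n × (Fin k ⊕ Fin (k - 1)))) :
    chainEdgeColor k n q u v = chainEdgeColor k n q v u := by
  rcases u with _ | ⟨i, x | y⟩ <;> rcases v with _ | ⟨j, x' | y'⟩ <;>
    simp [chainEdgeColor, max_comm]

section coloring

variable {q : ℕ}

theorem circOk_vertex_vertex (hk : 2 ≤ k) (hq : 0 < q)
    {u v : Option (Fin (2 * q) × (Fin k ⊕ Fin (k - 1)))} (h : (Gkn k (2 * q)).Adj u v) :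
    circOk ((k + 1) * q + 1) q (chainVertexColor k (2 * q) q u % ((k + 1) * q + 1))
      (chainVertexColor k (2 * q) q v % ((k + 1) * q + 1)) := by
  have hkq : 2 * q ≤ k * q := Nat.mul_le_mul_right q hk
  have hqk : q * k = k * q := mul_comm _ _
  have hp : (k + 1) * q = k * q + q := by ring
  have hnone : ∀ (j : Fin (2 * q)) (x : Fin k),
      (Gkn k (2 * q)).Adj none (some (j, .inl x)) →
      circOk ((k + 1) * q + 1) q (q % ((k + 1) * q + 1))
        ((j + 1 + q * latin k x 0) % ((k + 1) * q + 1)) := by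
    intro j x h
    rcases Gkn_adj_none_inl.1 h with ⟨hj, hx⟩ | ⟨hj, hx⟩ <;> rw [hj, hx]
    · rw [latin_one_zero hk]
      apply circOk_mod hq <;> omega
    · rw [latin_zero_zero]
      apply circOk_mod hq <;> omega
  have hlink : ∀ (i j : Fin (2 * q)) (x x' : Fin k),
      (j : ℕ) = i + 1 → (x : ℕ) = 0 → (x' : ℕ) = 1 →
      circOk ((k + 1) * q + 1) q ((i + 1 + q * latin k x 0) % ((k + 1) * q + 1))
        ((j + 1 + q * latin k x' 0) % ((k + 1) * q + 1)) := by
    intro i j x x' hj hx hx'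
    rw [hj, hx, hx', latin_zero_zero, latin_one_zero hk]
    apply circOk_mod hq <;> omega
  have hblock : ∀ (i : ℕ) (x : Fin k), circOk ((k + 1) * q + 1) q
      ((i + 1) % ((k + 1) * q + 1)) ((i + 1 + q * latin k x 0) % ((k + 1) * q + 1)) :=
    fun i x => circOk_lattice_link hq (latin_pos _ _) (latin_le (by omega)) (.inr rfl)
  rcases u with _ | ⟨i, x | y⟩ <;> rcases v with _ | ⟨j, x' | y'⟩
  · exact absurd h Gkn_not_adj_none_none
  · exact hnone j x' h
  · exact absurd h Gkn_not_adj_none_inr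
  · exact (hnone i x h.symm).symm
  · rcases Gkn_adj_inl_inl.1 h with ⟨h₁, h₂, h₃⟩ | ⟨h₁, h₂, h₃⟩
    · exact hlink i j x x' h₁ h₂ h₃
    · exact (hlink j i x' x h₁ h₂ h₃).symm
  · obtain rfl := Gkn_adj_inl_inr.1 h
    exact (hblock i x).symm
  · exact absurd h Gkn_not_adj_inr_none
  · obtain rfl := Gkn_adj_inr_inl.1 h
    exact hblock j x'
  · exact absurd h Gkn_not_adj_inr_inr

/-- At a vertex of the larger side of block `i`, the edge leaving the block has colour `i` or
`i + 1`. -/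
theorem chainEdgeColor_link {i : Fin n} {x : Fin k} {w : Option (Fin n × (Fin k ⊕ Fin (k - 1)))}
    (h : (Gkn k n).Adj (some (i, .inl x)) w) (hw : ∀ y, w ≠ some (i, .inr y)) :
    chainEdgeColor k n q (some (i, .inl x)) w = i ∨
      chainEdgeColor k n q (some (i, .inl x)) w = i + 1 := by
  have := i.isLt
  rcases w with _ | ⟨j, x' | y⟩
  · have := Gkn_adj_inl_none.1 h
    simp only [chainEdgeColor]
    split_ifs <;> omega
  · have := Gkn_adj_inl_inl.1 h
    simp only [chainEdgeColor]
    omega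
  · exact absurd (by rw [Gkn_adj_inl_inr.1 h]) (hw y)

/-- At most one edge leaves the block at each vertex of its larger side. -/
theorem Gkn_link_unique {i : Fin n} {x : Fin k} {v w : Option (Fin n × (Fin k ⊕ Fin (k - 1)))}
    (hv : (Gkn k n).Adj (some (i, .inl x)) v) (hw : (Gkn k n).Adj (some (i, .inl x)) w)
    (hv' : ∀ y, v ≠ some (i, .inr y)) (hw' : ∀ y, w ≠ some (i, .inr y)) : v = w := by
  rcases v with _ | ⟨j, x' | y⟩
  · rcases w with _ | ⟨j', x'' | y'⟩
    · rfl
    · have := Gkn_adj_inl_none.1 hv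
      have := Gkn_adj_inl_inl.1 hw
      omega
    · exact absurd (by rw [Gkn_adj_inl_inr.1 hw]) (hw' y')
  · have := Gkn_adj_inl_inl.1 hv
    rcases w with _ | ⟨j', x'' | y'⟩
    · have := Gkn_adj_inl_none.1 hw
      omega
    · have := Gkn_adj_inl_inl.1 hw
      simp only [Option.some.injEq, Prod.mk.injEq, Sum.inl.injEq, Fin.ext_iff]
      omega
    · exact absurd (by rw [Gkn_adj_inl_inr.1 hw]) (hw' y')
  · exact absurd (by rw [Gkn_adj_inl_inr.1 hv]) (hv' y)

theorem circOk_edge_edge (hk : 2 ≤ k) (hq : 0 < q)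
    {u v w : Option (Fin (2 * q) × (Fin k ⊕ Fin (k - 1)))} (hv : (Gkn k (2 * q)).Adj u v)
    (hw : (Gkn k (2 * q)).Adj u w) (hvw : v ≠ w) :
    circOk ((k + 1) * q + 1) q (chainEdgeColor k (2 * q) q u v % ((k + 1) * q + 1))
      (chainEdgeColor k (2 * q) q u w % ((k + 1) * q + 1)) := by
  have hkq : 2 * q ≤ k * q := Nat.mul_le_mul_right q hk
  have hp : (k + 1) * q = k * q + q := by ring
  have hk₀ : 0 < k := by omega
  rcases u with _ | ⟨i, x | y⟩
  · rcases v with _ | ⟨j, x | y⟩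
    · exact absurd hv Gkn_not_adj_none_none
    · rcases w with _ | ⟨j', x' | y'⟩
      · exact absurd hw Gkn_not_adj_none_none
      · have hv' := Gkn_adj_none_inl.1 hv
        have hw' := Gkn_adj_none_inl.1 hw
        simp only [ne_eq, Option.some.injEq, Prod.mk.injEq, Sum.inl.injEq, Fin.ext_iff] at hvw
        have h₀ : circOk ((k + 1) * q + 1) q (0 % ((k + 1) * q + 1))
            ((2 * q) % ((k + 1) * q + 1)) := by
          apply circOk_mod hq <;> omega
        simp only [chainEdgeColor]
        split_ifs
        · omega
        · exact h₀.symm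
        · exact h₀
        · omega
      · exact absurd hw Gkn_not_adj_none_inr
    · exact absurd hv Gkn_not_adj_none_inr
  · have hblock : ∀ y w, (Gkn k (2 * q)).Adj (some (i, .inl x)) w →
        (∀ y, w ≠ some (i, .inr y)) → circOk ((k + 1) * q + 1) q
          (chainEdgeColor k (2 * q) q (some (i, .inl x)) w % ((k + 1) * q + 1))
          (chainEdgeColor k (2 * q) q (some (i, .inl x)) (some (i, .inr y)) %
            ((k + 1) * q + 1)) := fun y w hw hw' =>
      circOk_lattice_link hq (latin_pos _ _) (latin_le hk₀) (chainEdgeColor_link hw hw')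
    by_cases hv' : ∃ y, v = some (i, .inr y)
    · obtain ⟨y, rfl⟩ := hv'
      by_cases hw' : ∃ y, w = some (i, .inr y)
      · obtain ⟨y', rfl⟩ := hw'
        refine circOk_lattice hq (latin_le hk₀) (latin_le hk₀)
          (latin_ne_right (by omega) (by omega) fun he => hvw ?_)
        rw [Fin.ext (Nat.succ_injective he)]
      · exact (hblock y w hw (not_exists.1 hw')).symm
    · by_cases hw' : ∃ y, w = some (i, .inr y)
      · obtain ⟨y', rfl⟩ := hw'
        exact hblock y' v hv (not_exists.1 hv')
      · exact absurd (Gkn_link_unique hv hw (not_exists.1 hv') (not_exists.1 hw')) hvw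
  · rcases v with _ | ⟨j, x | y'⟩
    · exact absurd hv Gkn_not_adj_inr_none
    · rcases w with _ | ⟨j', x' | y'⟩
      · exact absurd hw Gkn_not_adj_inr_none
      · obtain rfl := Gkn_adj_inr_inl.1 hv
        obtain rfl := Gkn_adj_inr_inl.1 hw
        refine circOk_lattice hq (latin_le hk₀) (latin_le hk₀)
          (latin_ne_left x.isLt x'.isLt fun he => hvw ?_)
        rw [Fin.ext he]
      · exact absurd hw Gkn_not_adj_inr_inr
    · exact absurd hv Gkn_not_adj_inr_inr

theorem circOk_edge_vertex (hk : 2 ≤ k) (hq : 0 < q)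
    {u v : Option (Fin (2 * q) × (Fin k ⊕ Fin (k - 1)))} (h : (Gkn k (2 * q)).Adj u v) :
    circOk ((k + 1) * q + 1) q (chainEdgeColor k (2 * q) q u v % ((k + 1) * q + 1))
      (chainVertexColor k (2 * q) q u % ((k + 1) * q + 1)) := by
  have hkq : 2 * q ≤ k * q := Nat.mul_le_mul_right q hk
  have hp : (k + 1) * q = k * q + q := by ring
  have hk₀ : 0 < k := by omega
  rcases u with _ | ⟨i, x | y⟩
  · rcases v with _ | ⟨j, x | y⟩
    · exact absurd h Gkn_not_adj_none_none
    · simp only [chainEdgeColor, chainVertexColor]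
      split_ifs
      · apply circOk.symm
        apply circOk_mod hq <;> omega
      · apply circOk_mod hq <;> omega
    · exact absurd h Gkn_not_adj_none_inr
  · by_cases hv : ∃ y, v = some (i, .inr y)
    · obtain ⟨y, rfl⟩ := hv
      exact circOk_lattice hq (latin_le hk₀) (latin_le hk₀)
        (latin_ne_right (by omega) (by omega) (by omega))
    · exact circOk_lattice_link hq (latin_pos _ _) (latin_le hk₀)
        (chainEdgeColor_link h (not_exists.1 hv))
  · rcases v with _ | ⟨j, x | y'⟩
    · exact absurd h Gkn_not_adj_inr_none
    · obtain rfl := Gkn_adj_inr_inl.1 h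
      exact (circOk_lattice_link hq (latin_pos _ _) (latin_le hk₀) (.inr rfl)).symm
    · exact absurd h Gkn_not_adj_inr_inr

theorem isCircTotalColoring_Gkn (hk : 2 ≤ k) (hq : 0 < q) :
    IsCircTotalColoring (Gkn k (2 * q)) ((k + 1) * q + 1) q
      (fun v => chainVertexColor k (2 * q) q v % ((k + 1) * q + 1))
      (fun u v => chainEdgeColor k (2 * q) q u v % ((k + 1) * q + 1)) := by
  refine ⟨fun v => Nat.mod_lt _ (Nat.succ_pos _), fun u v _ => Nat.mod_lt _ (Nat.succ_pos _),
    fun u v _ => congrArg (· % _) (chainEdgeColor_comm u v),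
    fun u v => circOk_vertex_vertex hk hq, fun u v w => circOk_edge_edge hk hq,
    fun u v h => ⟨circOk_edge_vertex hk hq h, ?_⟩⟩
  beta_reduce
  rw [chainEdgeColor_comm]
  exact circOk_edge_vertex hk hq h.symm

end coloring

end Gkn

/-! ### The main theorem -/

theorem circTotalChromatic_le {V : Type*} {G : SimpleGraph V} {p q : ℕ} {cv : V → ℕ}
    {ce : V → V → ℕ} (hq : 0 < q) (h : IsCircTotalColoring G p q cv ce) :
    circTotalChromatic G ≤ (p : ℝ) / q := by
  refine csInf_le ⟨0, ?_⟩ ⟨p, q, hq, ⟨cv, ce, h⟩, rfl⟩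
  rintro x ⟨p, q, -, -, rfl⟩
  positivity

theorem infinite_of_forall_pos_exists {S : Set ℝ} (a : ℝ)
    (h : ∀ ε > 0, ∃ x ∈ S, a < x ∧ x < a + ε) : S.Infinite := by
  intro hfin
  obtain ⟨x₀, hx₀, ha₀, -⟩ := h 1 one_pos
  obtain ⟨x, ⟨hx, hax⟩, hmin⟩ := Set.exists_min_image (S ∩ Set.Ioi a) id
    (hfin.subset Set.inter_subset_left) ⟨x₀, hx₀, ha₀⟩
  obtain ⟨y, hy, hay, hyx⟩ := h (x - a) (sub_pos.2 hax)
  have := hmin y ⟨hy, hay⟩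
  simp only [id] at this
  linarith

theorem stmt12 (k : ℕ) (hk : 2 ≤ k) :
    {x : ℝ | ∃ (m : ℕ) (G : SimpleGraph (Fin m)),
        (∀ v, (G.neighborSet v).ncard ≤ k) ∧ (∃ v, (G.neighborSet v).ncard = k) ∧
        x = circTotalChromatic G}.Infinite := by
  refine infinite_of_forall_pos_exists ((k : ℝ) + 1) fun ε hε => ?_
  obtain ⟨m, hm⟩ := exists_nat_one_div_lt hε
  let q := m + 1
  have hq : 0 < q := m.succ_pos
  have hcol := isCircTotalColoring_Gkn hk hq
  let e := Fintype.equivFin (Option (Fin (2 * q) × (Fin k ⊕ Fin (k - 1))))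
  let φ : (Gkn k (2 * q)).comap e.symm ≃g Gkn k (2 * q) := Iso.comap e.symm _
  refine ⟨circTotalChromatic (Gkn k (2 * q)), ⟨_, (Gkn k (2 * q)).comap e.symm, ?_, ?_,
    (circTotalChromatic_congr φ).symm⟩, ?_, ?_⟩
  · intro v
    rw [ncard_neighborSet_congr φ]
    exact Gkn_ncard_neighborSet_le hk _
  · refine ⟨φ.symm (some (⟨0, by omega⟩, .inr ⟨0, by omega⟩)), ?_⟩
    rw [ncard_neighborSet_congr φ, φ.apply_symm_apply]
    exact Gkn_ncard_neighborSet_inr _ _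
  · by_contra! hle
    exact Gkn_not_isTotalColoring hk (by omega : 0 < 2 * q)
      (exists_isTotalColoring_of_circTotalChromatic_le _ k.succ_pos ⟨_, _, _, _, hq, hcol⟩
        (by exact_mod_cast hle))
  · refine (circTotalChromatic_le hq hcol).trans_lt ?_
    have : (((k + 1) * q + 1 : ℕ) : ℝ) / q = k + 1 + 1 / ((m : ℝ) + 1) := by
      simp only [q]
      push_cast
      field_simp
    linarith
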